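/- (Lemma 3) Let a₁, a₂, b₁, b₂ > 0, and let X and Y be independent random variables with X distributed as Gamma(a₁, 1/b₁) and Y distributed as Gamma(a₂, 1/b₂). Then the random variable C₁ := log₂(1 + X/Y) has law absolutely continuous with respect to Lebesgue measure, with density f_{C₁}(x) = 2^x · ln 2 · (2^x − 1)^{a₁ − 1} · [Γ(a₁ + a₂)/(Γ(a₁) Γ(a₂) b₁^{a₁} b₂^{a₂})] · (1/b₂ + (2^x − 1)/b₁)^{−(a₁ + a₂)} for x > 0 and f_{C₁}(x) = 0 for x ≤ 0; consequently its cumulative distribution function is F_{C₁}(x) = ∫₀^x f_{C₁}(t) dt for x ≥ 0. -/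

import Mathlib

open MeasureTheory ProbabilityTheory Real
open scoped NNReal ENNReal

/-- The density of `C₁ = log₂(1 + X/Y)` where `X ~ Gamma(a₁, 1/b₁)` and
`Y ~ Gamma(a₂, 1/b₂)` are independent. -/
noncomputable def rateDensity₁ (a₁ a₂ b₁ b₂ x : ℝ) : ℝ :=
  if 0 < x then
    (2 : ℝ) ^ x * Real.log 2 * ((2 : ℝ) ^ x - 1) ^ (a₁ - 1)
      * (Real.Gamma (a₁ + a₂) / (Real.Gamma a₁ * Real.Gamma a₂ * b₁ ^ a₁ * b₂ ^ a₂))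
      * (1 / b₂ + ((2 : ℝ) ^ x - 1) / b₁) ^ (-(a₁ + a₂))
  else 0

theorem measurable_rateDensity₁ (a₁ a₂ b₁ b₂ : ℝ) :
    Measurable (rateDensity₁ a₁ a₂ b₁ b₂) := by
  unfold rateDensity₁
  refine Measurable.ite measurableSet_Ioi ?_ measurable_const
  fun_prop

theorem rateDensity₁_nonneg {a₁ a₂ b₁ b₂ : ℝ} (ha₁ : 0 < a₁) (ha₂ : 0 < a₂) (hb₁ : 0 < b₁)
    (hb₂ : 0 < b₂) (x : ℝ) : 0 ≤ rateDensity₁ a₁ a₂ b₁ b₂ x := by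
  unfold rateDensity₁
  split_ifs with hx
  · have h1 : 0 < (2 : ℝ) ^ x - 1 := sub_pos.2 (Real.one_lt_rpow one_lt_two hx)
    have h2 : 0 < Real.log 2 := Real.log_pos one_lt_two
    positivity
  · exact le_rfl

/-- The joint density of `(C₁, Y)` factors into the density of `C₁` and a Gamma density in `y`. -/
theorem rateDensity₁_mul_gammaPDF {a₁ a₂ b₁ b₂ t y : ℝ} (ha₁ : 0 < a₁) (ha₂ : 0 < a₂)
    (hb₁ : 0 < b₁) (hb₂ : 0 < b₂) (ht : 0 < t) (hy : 0 < y) :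
    gammaPDF a₂ (1 / b₂) y * (ENNReal.ofReal (y * ((2 : ℝ) ^ t * Real.log 2)) *
        gammaPDF a₁ (1 / b₁) (y * ((2 : ℝ) ^ t - 1)))
      = ENNReal.ofReal (rateDensity₁ a₁ a₂ b₁ b₂ t) *
        gammaPDF (a₁ + a₂) (1 / b₂ + ((2 : ℝ) ^ t - 1) / b₁) y := by
  have h1 : 0 < (2 : ℝ) ^ t - 1 := sub_pos.2 (Real.one_lt_rpow one_lt_two ht)
  have h2 : 0 < Real.log 2 := Real.log_pos one_lt_two
  have hr₁ : 0 < 1 / b₁ := by positivity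
  have hr₂ : 0 < 1 / b₂ := by positivity
  have hJ : 0 ≤ y * ((2 : ℝ) ^ t * Real.log 2) := by positivity
  simp only [gammaPDF]
  rw [← ENNReal.ofReal_mul hJ, ← ENNReal.ofReal_mul (gammaPDFReal_nonneg ha₂ hr₂ y),
    ← ENNReal.ofReal_mul (rateDensity₁_nonneg ha₁ ha₂ hb₁ hb₂ t)]
  congr 1
  unfold gammaPDFReal rateDensity₁
  rw [if_pos hy.le, if_pos (by positivity), if_pos hy.le, if_pos ht]
  set u := (2 : ℝ) ^ t - 1
  have hr : 0 < 1 / b₂ + u / b₁ := by positivity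
  have hexp : Real.exp (-((1 / b₂ + u / b₁) * y))
      = Real.exp (-(1 / b₂ * y)) * Real.exp (-(1 / b₁ * (y * u))) := by
    rw [← Real.exp_add]
    congr 1
    ring
  have hpow : y ^ (a₁ + a₂ - 1) = y * y ^ (a₁ - 1) * y ^ (a₂ - 1) := by
    rw [show a₁ + a₂ - 1 = 1 + (a₁ - 1) + (a₂ - 1) by ring, Real.rpow_add hy, Real.rpow_add hy,
      Real.rpow_one]
  rw [hexp, hpow, Real.rpow_neg hr.le, Real.mul_rpow hy.le h1.le,
    Real.div_rpow zero_le_one hb₁.le, Real.div_rpow zero_le_one hb₂.le, Real.one_rpow,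
    Real.one_rpow]
  have e1 := (Real.rpow_pos_of_pos hr (a₁ + a₂)).ne'
  have e2 := (Real.rpow_pos_of_pos hb₁ a₁).ne'
  have e3 := (Real.rpow_pos_of_pos hb₂ a₂).ne'
  have e4 := (Real.Gamma_pos_of_pos ha₁).ne'
  have e5 := (Real.Gamma_pos_of_pos ha₂).ne'
  have e6 := (Real.Gamma_pos_of_pos (add_pos ha₁ ha₂)).ne'
  generalize (1 / b₂ + u / b₁) ^ (a₁ + a₂) = R at *
  generalize b₁ ^ a₁ = B₁ at *
  generalize b₂ ^ a₂ = B₂ at *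
  field_simp

theorem setLIntegral_Ioi_gammaPDF {a r : ℝ} (ha : 0 < a) (hr : 0 < r) :
    ∫⁻ x in Set.Ioi 0, gammaPDF a r x = 1 := by
  rw [setLIntegral_congr Ioi_ae_eq_Ici, ← lintegral_gammaPDF_eq_one ha hr,
    ← lintegral_add_compl (μ := volume) (gammaPDF a r) (measurableSet_Ici (a := 0)), Set.compl_Ici,
    lintegral_gammaPDF_of_nonpos le_rfl, add_zero]

theorem lintegral_gammaMeasure {a r : ℝ} {f : ℝ → ℝ≥0∞} (hf : Measurable f) :
    ∫⁻ x, f x ∂gammaMeasure a r = ∫⁻ x in Set.Ioi 0, gammaPDF a r x * f x := by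
  have hm : Measurable (gammaPDF a r) := (measurable_gammaPDFReal a r).ennreal_ofReal
  rw [gammaMeasure, lintegral_withDensity_eq_lintegral_mul _ hm hf,
    setLIntegral_congr Ioi_ae_eq_Ici]
  refine (setLIntegral_eq_of_support_subset ?_).symm
  intro x hx
  by_contra h
  exact hx (by simp [gammaPDF_of_neg (not_le.1 h)])

/-- Change of variables `x = y (2 ^ t - 1)`. -/
theorem setLIntegral_Ioi_comp_logb_one_add_div {y : ℝ} (hy : 0 < y) (p g : ℝ → ℝ≥0∞) :
    ∫⁻ x in Set.Ioi 0, p x * g (Real.logb 2 (1 + x / y))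
      = ∫⁻ t in Set.Ioi 0, ENNReal.ofReal (y * ((2 : ℝ) ^ t * Real.log 2)) *
          p (y * ((2 : ℝ) ^ t - 1)) * g t := by
  have h2 : 0 < Real.log 2 := Real.log_pos one_lt_two
  have hinv (t : ℝ) : Real.logb 2 (1 + y * ((2 : ℝ) ^ t - 1) / y) = t := by
    rw [mul_div_cancel_left₀ _ hy.ne', add_sub_cancel, Real.logb_rpow two_pos (by norm_num)]
  have himg : (fun t : ℝ => y * ((2 : ℝ) ^ t - 1)) '' Set.Ioi 0 = Set.Ioi 0 := by
    ext x
    constructor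
    · rintro ⟨t, ht, rfl⟩
      exact mul_pos hy (sub_pos.2 (Real.one_lt_rpow one_lt_two ht))
    · intro hx
      have hxy : 0 < x / y := div_pos hx hy
      refine ⟨Real.logb 2 (1 + x / y), Real.logb_pos one_lt_two (by linarith), ?_⟩
      change y * ((2 : ℝ) ^ Real.logb 2 (1 + x / y) - 1) = x
      rw [Real.rpow_logb two_pos (by norm_num) (by linarith)]
      field_simp
      ring
  have hinj : Set.InjOn (fun t : ℝ => y * ((2 : ℝ) ^ t - 1)) (Set.Ioi 0) := by
    intro s _ t _ hst
    rw [← hinv s, ← hinv t]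
    exact congrArg (fun z => Real.logb 2 (1 + z / y)) hst
  have hderiv (t : ℝ) : HasDerivAt (fun t : ℝ => y * ((2 : ℝ) ^ t - 1))
      (y * ((2 : ℝ) ^ t * Real.log 2)) t :=
    ((Real.hasStrictDerivAt_const_rpow two_pos t).hasDerivAt.sub_const 1).const_mul y
  rw [← himg, lintegral_image_eq_lintegral_abs_deriv_mul measurableSet_Ioi
    (fun t _ => (hderiv t).hasDerivWithinAt) hinj, himg]
  refine lintegral_congr fun t => ?_
  rw [hinv, abs_of_pos (by positivity), mul_assoc]

theorem lintegral_comp_logb_one_add_div_gammaMeasure {a₁ a₂ b₁ b₂ : ℝ} (ha₁ : 0 < a₁)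
    (ha₂ : 0 < a₂) (hb₁ : 0 < b₁) (hb₂ : 0 < b₂) {g : ℝ → ℝ≥0∞} (hg : Measurable g) :
    ∫⁻ y, ∫⁻ x, g (Real.logb 2 (1 + x / y)) ∂gammaMeasure a₁ (1 / b₁) ∂gammaMeasure a₂ (1 / b₂)
      = ∫⁻ t, ENNReal.ofReal (rateDensity₁ a₁ a₂ b₁ b₂ t) * g t := by
  have hr₁ : 0 < 1 / b₁ := by positivity
  have : IsProbabilityMeasure (gammaMeasure a₁ (1 / b₁)) :=
    isProbabilityMeasure_gammaMeasure ha₁ hr₁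
  have hm (a r : ℝ) : Measurable (gammaPDF a r) := (measurable_gammaPDFReal a r).ennreal_ofReal
  have hm₁ := hm a₁ (1 / b₁)
  have hm₂ := hm a₂ (1 / b₂)
  have hlog : Measurable fun z : ℝ × ℝ => Real.logb 2 (1 + z.2 / z.1) := by
    unfold Real.logb
    fun_prop
  have hglog : Measurable fun z : ℝ × ℝ => g (Real.logb 2 (1 + z.2 / z.1)) := hg.comp hlog
  calc
    _ = ∫⁻ y in Set.Ioi 0, ∫⁻ t in Set.Ioi 0, gammaPDF a₂ (1 / b₂) y *
          (ENNReal.ofReal (y * ((2 : ℝ) ^ t * Real.log 2)) *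
            gammaPDF a₁ (1 / b₁) (y * ((2 : ℝ) ^ t - 1)) * g t) := by
      rw [lintegral_gammaMeasure hglog.lintegral_prod_right']
      refine setLIntegral_congr_fun measurableSet_Ioi fun y hy => ?_
      have hgy : Measurable fun x => g (Real.logb 2 (1 + x / y)) :=
        hglog.comp measurable_prodMk_left
      dsimp only
      rw [lintegral_gammaMeasure hgy, setLIntegral_Ioi_comp_logb_one_add_div hy,
        lintegral_const_mul _ (by fun_prop)]
    _ = ∫⁻ t in Set.Ioi 0, ∫⁻ y in Set.Ioi 0, gammaPDF a₂ (1 / b₂) y *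
          (ENNReal.ofReal (y * ((2 : ℝ) ^ t * Real.log 2)) *
            gammaPDF a₁ (1 / b₁) (y * ((2 : ℝ) ^ t - 1)) * g t) :=
      lintegral_lintegral_swap (by unfold Function.uncurry; fun_prop)
    _ = ∫⁻ t in Set.Ioi 0, ENNReal.ofReal (rateDensity₁ a₁ a₂ b₁ b₂ t) * g t := by
      refine setLIntegral_congr_fun measurableSet_Ioi fun t ht => ?_
      have h1 : 0 < (2 : ℝ) ^ t - 1 := sub_pos.2 (Real.one_lt_rpow one_lt_two ht)
      have hr : 0 < 1 / b₂ + ((2 : ℝ) ^ t - 1) / b₁ := by positivity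
      calc
        _ = ∫⁻ y in Set.Ioi 0, ENNReal.ofReal (rateDensity₁ a₁ a₂ b₁ b₂ t) * g t *
              gammaPDF (a₁ + a₂) (1 / b₂ + ((2 : ℝ) ^ t - 1) / b₁) y := by
          refine setLIntegral_congr_fun measurableSet_Ioi fun y hy => ?_
          rw [← mul_assoc, rateDensity₁_mul_gammaPDF ha₁ ha₂ hb₁ hb₂ ht hy, mul_right_comm]
        _ = _ := by
          rw [lintegral_const_mul _ (hm _ _),
            setLIntegral_Ioi_gammaPDF (add_pos ha₁ ha₂) hr, mul_one]
    _ = _ := by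
      refine setLIntegral_eq_of_support_subset fun t ht => ?_
      by_contra h
      exact ht (by simp [rateDensity₁, show ¬ 0 < t from h])

/-- (Lemma 3) If `X ~ Gamma(a₁, 1/b₁)` and `Y ~ Gamma(a₂, 1/b₂)` are
independent, then `C₁ = log₂(1 + X/Y)` has a law absolutely continuous w.r.t.
Lebesgue measure with density
`f_{C₁}(x) = 2^x ln 2 (2^x-1)^{a₁-1} Γ(a₁+a₂)/(Γ(a₁)Γ(a₂) b₁^{a₁} b₂^{a₂}) ·
(1/b₂ + (2^x-1)/b₁)^{-(a₁+a₂)}` for `x > 0` (and `0` for `x ≤ 0`); consequently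
`F_{C₁}(x) = ∫₀^x f_{C₁}(t) dt` for `x ≥ 0`. -/
theorem rate_C1_density
    {Ω : Type*} [MeasurableSpace Ω] (Pr : Measure Ω) [IsProbabilityMeasure Pr]
    (a₁ a₂ b₁ b₂ : ℝ) (ha₁ : 0 < a₁) (ha₂ : 0 < a₂) (hb₁ : 0 < b₁) (hb₂ : 0 < b₂)
    (X Y : Ω → ℝ) (hX : Measurable X) (hY : Measurable Y)
    (hindep : IndepFun X Y Pr)
    (hXlaw : Measure.map X Pr = gammaMeasure a₁ (1 / b₁))
    (hYlaw : Measure.map Y Pr = gammaMeasure a₂ (1 / b₂))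
    (C₁ : Ω → ℝ) (hC₁ : C₁ = fun ω => Real.logb 2 (1 + X ω / Y ω)) :
    Measure.map C₁ Pr
      = volume.withDensity (fun x => ENNReal.ofReal (rateDensity₁ a₁ a₂ b₁ b₂ x)) ∧
    ∀ x : ℝ, 0 ≤ x →
      (Pr {ω | C₁ ω ≤ x}).toReal = ∫ t in (0 : ℝ)..x, rateDensity₁ a₁ a₂ b₁ b₂ t := by
  have hr₁ : 0 < 1 / b₁ := by positivity
  have hr₂ : 0 < 1 / b₂ := by positivity
  have := isProbabilityMeasure_gammaMeasure ha₁ hr₁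
  have := isProbabilityMeasure_gammaMeasure ha₂ hr₂
  have hφ : Measurable fun z : ℝ × ℝ => Real.logb 2 (1 + z.1 / z.2) := by
    unfold Real.logb
    fun_prop
  have hC : Measurable C₁ := hC₁ ▸ hφ.comp (hX.prodMk hY)
  have hd : Measurable fun x => ENNReal.ofReal (rateDensity₁ a₁ a₂ b₁ b₂ x) :=
    (measurable_rateDensity₁ a₁ a₂ b₁ b₂).ennreal_ofReal
  have hlaw : Measure.map C₁ Pr
      = volume.withDensity (fun x => ENNReal.ofReal (rateDensity₁ a₁ a₂ b₁ b₂ x)) := by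
    refine Measure.ext_of_lintegral _ fun g hg => ?_
    have hgφ : Measurable fun z : ℝ × ℝ => g (Real.logb 2 (1 + z.1 / z.2)) := hg.comp hφ
    have hjoint := (indepFun_iff_map_prod_eq_prod_map_map hX.aemeasurable hY.aemeasurable).1 hindep
    calc
      _ = ∫⁻ z, g (Real.logb 2 (1 + z.1 / z.2)) ∂(Measure.map (fun ω => (X ω, Y ω)) Pr) := by
        rw [lintegral_map hg hC, lintegral_map hgφ (hX.prodMk hY), hC₁]
      _ = _ := by
        rw [hjoint, hXlaw, hYlaw, lintegral_prod_symm _ hgφ.aemeasurable,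
          lintegral_withDensity_eq_lintegral_mul _ hd hg]
        exact lintegral_comp_logb_one_add_div_gammaMeasure ha₁ ha₂ hb₁ hb₂ hg
  refine ⟨hlaw, fun x hx => ?_⟩
  have hcdf : Pr {ω | C₁ ω ≤ x}
      = ∫⁻ t in Set.Iic x, ENNReal.ofReal (rateDensity₁ a₁ a₂ b₁ b₂ t) := by
    rw [← withDensity_apply _ measurableSet_Iic, ← hlaw, Measure.map_apply hC measurableSet_Iic]
    rfl
  rw [hcdf, ← integral_eq_lintegral_of_nonneg_ae
    (ae_of_all _ (rateDensity₁_nonneg ha₁ ha₂ hb₁ hb₂))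
    (measurable_rateDensity₁ a₁ a₂ b₁ b₂).aestronglyMeasurable,
    intervalIntegral.integral_of_le hx]
  refine setIntegral_eq_of_subset_of_forall_sdiff_eq_zero measurableSet_Iic
    Set.Ioc_subset_Iic_self fun t ht => ?_
  exact if_neg fun h => ht.2 ⟨h, ht.1⟩
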